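/- Let 𝒳 ⊆ ℝ^d be a nonempty closed convex set, ν ∈ (0, 1), L > 0, σ > 0, and let f : ℝ^d → ℝ be differentiable with ‖∇f(y) − ∇f(x)‖ ≤ L‖y − x‖^ν for all x, y ∈ 𝒳 and f ≥ f* on 𝒳. On a probability space with filtration (𝓕_k), let γ_k > 0 with γ_k ≤ γ̄ for some γ̄ > 0, m_k ≥ 1, x_0 ∈ 𝒳 deterministic, and let (x_k), (G_k) be random sequences in ℝ^d with: x_k 𝓕_k-measurable with values in 𝒳; E[G_k | 𝓕_k] = ∇f(x_k) a.s.; E[‖∇f(x_k) − G_k‖²] ≤ σ²/m_k; E[‖G_k‖^{1+ν}] ≤ σ^{1+ν}; and x_{k+1} almost surely the Euclidean projection of x_k − γ_k G_k onto 𝒳. Then for every N ≥ 1, min_{k=0,…,N−1} E[ dist(0, ∇f(x_{k+1}) + N_𝒳(x_{k+1})) ] ≤ [ (1+Lν) √N √( Δ + σ² Σ_{k=0}^{N−1}(γ_k/m_k) + (Lσ^{1+ν}/(1+ν)) Σ_{k=0}^{N−1} γ_k^{1+ν} ) + L(1−ν) Σ_{k=0}^{N−1} γ_k^{(ν+1)/(2(1−ν))}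 + σ Σ_{k=0}^{N−1} √(γ_k/m_k) ] / Σ_{k=0}^{N−1} √γ_k, where Δ := f(x_0) − f*. -/

import Mathlib

open MeasureTheory InnerProductSpace

section det
set_option linter.unusedSectionVars false
variable {E : Type*} [NormedAddCommGroup E] [InnerProductSpace ℝ E] [CompleteSpace E]

lemma spg_descent (X : Set E) (hX : Convex ℝ X) (ν L : ℝ) (hν : 0 < ν)
    (f : E → ℝ) (hf : Differentiable ℝ f)
    (hH : ∀ x ∈ X, ∀ y ∈ X, ‖gradient f y - gradient f x‖ ≤ L * ‖y - x‖ ^ ν)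
    (x y : E) (hx : x ∈ X) (hy : y ∈ X) :
    f y ≤ f x + ⟪gradient f x, y - x⟫_ℝ + L / (1 + ν) * ‖y - x‖ ^ (1 + ν) := by
  set c := ⟪gradient f x, y - x⟫_ℝ with hc
  set D := L / (1 + ν) * ‖y - x‖ ^ (1 + ν) with hD
  let φ : ℝ → ℝ := fun t => f (x + t • (y - x)) - t * c - D * t ^ (1 + ν)
  have hder : ∀ t : ℝ, HasDerivAt φ
      (⟪gradient f (x + t • (y - x)), y - x⟫_ℝ - c - D * ((1 + ν) * t ^ ν)) t := by
    intro t
    have h1 : HasDerivAt (fun t : ℝ => x + t • (y - x)) (y - x) t := by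
      simpa using ((hasDerivAt_id t).smul_const (y - x)).const_add x
    have h2 := (hf (x + t • (y - x))).hasGradientAt.hasFDerivAt.comp_hasDerivAt t h1
    have h3 : HasDerivAt (fun t : ℝ => t * c) c t := by
      simpa using (hasDerivAt_id t).mul_const c
    have h4 : HasDerivAt (fun t : ℝ => D * t ^ (1 + ν)) (D * ((1 + ν) * t ^ ν)) t := by
      have := (Real.hasDerivAt_rpow_const (x := t) (p := 1 + ν) (Or.inr (by linarith))).const_mul D
      simpa using this
    exact (h2.sub h3).sub h4
  have hanti : AntitoneOn φ (Set.Icc 0 1) := by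
    apply antitoneOn_of_deriv_nonpos (convex_Icc 0 1)
    · exact fun t _ => (hder t).continuousAt.continuousWithinAt
    · exact fun t _ => (hder t).differentiableAt.differentiableWithinAt
    · intro t ht
      rw [interior_Icc] at ht
      rw [(hder t).deriv]
      have hmem : x + t • (y - x) ∈ X := by
        have := hX.add_smul_sub_mem hx hy ⟨ht.1.le, ht.2.le⟩
        exact this
      have h1 := hH x hx _ hmem
      have h2 : ⟪gradient f (x + t • (y - x)), y - x⟫_ℝ - c
          ≤ ‖gradient f (x + t • (y - x)) - gradient f x‖ * ‖y - x‖ := by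
        rw [hc, ← inner_sub_left]; exact real_inner_le_norm _ _
      have h3 : ‖x + t • (y - x) - x‖ = t * ‖y - x‖ := by
        rw [add_sub_cancel_left, norm_smul, Real.norm_of_nonneg ht.1.le]
      rw [h3, Real.mul_rpow ht.1.le (norm_nonneg _)] at h1
      have h4 := mul_le_mul_of_nonneg_right h1 (norm_nonneg (y - x))
      have h5 : D * ((1 + ν) * t ^ ν) = L * (t ^ ν * ‖y - x‖ ^ ν) * ‖y - x‖ := by
        rw [hD, add_comm 1 ν, Real.rpow_add_one' (norm_nonneg _) (by linarith)]
        field_simp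
      linarith
  have := hanti (Set.left_mem_Icc.2 zero_le_one) (Set.right_mem_Icc.2 zero_le_one) zero_le_one
  have h0 : (0 : ℝ) ^ (1 + ν) = 0 := Real.zero_rpow (by linarith)
  simp only [φ, h0] at this
  simp at this
  linarith

lemma spg_nonexp (X : Set E) (z w p q : E) (hp : p ∈ X) (hq : q ∈ X)
    (h1 : ∀ y ∈ X, ⟪z - p, y - p⟫_ℝ ≤ 0) (h2 : ∀ y ∈ X, ⟪w - q, y - q⟫_ℝ ≤ 0) :
    ‖p - q‖ ≤ ‖z - w‖ := by
  have a := h1 q hq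
  have b := h2 p hp
  have h : ‖p - q‖ * ‖p - q‖ ≤ ⟪z - w, p - q⟫_ℝ := by
    rw [← real_inner_self_eq_norm_mul_norm]
    have e : ⟪z - w, p - q⟫_ℝ - ⟪p - q, p - q⟫_ℝ = - ⟪z - p, q - p⟫_ℝ - ⟪w - q, p - q⟫_ℝ := by
      simp only [inner_sub_left, inner_sub_right]; ring
    linarith
  have h' := h.trans (real_inner_le_norm _ _)
  by_contra! hlt
  have : 0 < ‖p - q‖ := (norm_nonneg _).trans_lt hlt
  nlinarith

lemma spg_proj (X : Set E) (hne : X.Nonempty) (hcl : IsClosed X) (hX : Convex ℝ X) :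
    ∃ p : E → E, Continuous p ∧ ∀ z, p z ∈ X ∧ ∀ y ∈ X, ⟪z - p z, y - p z⟫_ℝ ≤ 0 := by
  have h : ∀ z, ∃ v, v ∈ X ∧ ∀ y ∈ X, ⟪z - v, y - v⟫_ℝ ≤ 0 := by
    intro z
    obtain ⟨v, hv, hvz⟩ := exists_norm_eq_iInf_of_complete_convex hne hcl.isComplete hX z
    exact ⟨v, hv, (norm_eq_iInf_iff_real_inner_le_zero hX hv).1 hvz⟩
  choose p hp using h
  refine ⟨p, ?_, hp⟩
  apply LipschitzWith.continuous (K := 1)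
  apply LipschitzWith.of_dist_le_mul
  intro z w
  simpa [dist_eq_norm] using spg_nonexp X z w _ _ (hp z).1 (hp w).1 (hp z).2 (hp w).2

lemma spg_step_le (X : Set E) (x p G : E) (γ : ℝ) (hγ : 0 < γ) (hx : x ∈ X)
    (h1 : ∀ y ∈ X, ⟪(x - γ • G) - p, y - p⟫_ℝ ≤ 0) :
    ‖p - x‖ ^ 2 / γ ≤ - ⟪G, p - x⟫_ℝ ∧ ‖p - x‖ ≤ γ * ‖G‖ := by
  have a := h1 x hx
  have e : ⟪(x - γ • G) - p, x - p⟫_ℝ = ‖p - x‖ ^ 2 + γ * ⟪G, p - x⟫_ℝ := by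
    rw [← real_inner_self_eq_norm_sq]
    simp only [inner_sub_left, inner_sub_right, real_inner_smul_left]
    ring
  have h : ‖p - x‖ ^ 2 ≤ γ * - ⟪G, p - x⟫_ℝ := by linarith
  refine ⟨by rw [div_le_iff₀ hγ]; linarith, ?_⟩
  have h2 : - ⟪G, p - x⟫_ℝ ≤ ‖G‖ * ‖p - x‖ := by
    rw [← inner_neg_left]; simpa using real_inner_le_norm (-G) (p - x)
  have h3 := h.trans (mul_le_mul_of_nonneg_left h2 hγ.le)
  by_contra! hlt
  have : 0 < ‖p - x‖ := lt_of_le_of_lt (by positivity) hlt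
  nlinarith

lemma spg_onestep (X : Set E) (hX : Convex ℝ X) (ν L : ℝ) (hν : 0 < ν) (hL : 0 < L)
    (f : E → ℝ) (hf : Differentiable ℝ f)
    (hH : ∀ x ∈ X, ∀ y ∈ X, ‖gradient f y - gradient f x‖ ≤ L * ‖y - x‖ ^ ν)
    (x p q G : E) (γ : ℝ) (hγ : 0 < γ) (hx : x ∈ X) (hp : p ∈ X) (hq : q ∈ X)
    (h1 : ∀ y ∈ X, ⟪(x - γ • G) - p, y - p⟫_ℝ ≤ 0)
    (h2 : ∀ y ∈ X, ⟪(x - γ • gradient f x) - q, y - q⟫_ℝ ≤ 0) :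
    f p ≤ f x - ‖p - x‖ ^ 2 / γ + γ * ‖gradient f x - G‖ ^ 2 + ⟪q - x, gradient f x - G⟫_ℝ
      + L / (1 + ν) * γ ^ (1 + ν) * ‖G‖ ^ (1 + ν) := by
  have hd := spg_descent X hX ν L hν f hf hH x p hx hp
  obtain ⟨ha, hb⟩ := spg_step_le X x p G γ hγ hx h1
  have hc : L / (1 + ν) * ‖p - x‖ ^ (1 + ν) ≤ L / (1 + ν) * (γ ^ (1 + ν) * ‖G‖ ^ (1 + ν)) := by
    rw [← Real.mul_rpow hγ.le (norm_nonneg _)]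
    gcongr
  have hn := spg_nonexp X _ _ p q hp hq h1 h2
  have e1 : x - γ • G - (x - γ • gradient f x) = γ • (gradient f x - G) := by
    rw [smul_sub]; abel
  rw [e1, norm_smul, Real.norm_of_nonneg hγ.le] at hn
  have e2 : ⟪gradient f x - G, p - q⟫_ℝ ≤ γ * ‖gradient f x - G‖ ^ 2 := by
    refine (real_inner_le_norm _ _).trans ?_
    nlinarith [norm_nonneg (gradient f x - G)]
  have e3 : ⟪gradient f x, p - x⟫_ℝ = ⟪G, p - x⟫_ℝ + ⟪gradient f x - G, p - q⟫_ℝ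
      + ⟪q - x, gradient f x - G⟫_ℝ := by
    rw [real_inner_comm (gradient f x - G) (q - x)]
    simp only [inner_sub_left, inner_sub_right]; ring
  linarith

lemma spg_stat (X : Set E) (ν L : ℝ) (hν : 0 < ν) (hν1 : ν < 1) (hL : 0 < L)
    (f : E → ℝ)
    (hH : ∀ x ∈ X, ∀ y ∈ X, ‖gradient f y - gradient f x‖ ≤ L * ‖y - x‖ ^ ν)
    (x p G : E) (γ : ℝ) (hγ : 0 < γ) (hx : x ∈ X) (hp : p ∈ X)
    (h1 : ∀ y ∈ X, ⟪(x - γ • G) - p, y - p⟫_ℝ ≤ 0) :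
    Real.sqrt γ * Metric.infDist (0 : E)
        {v | ∃ u, (∀ y ∈ X, ⟪u, y - p⟫_ℝ ≤ 0) ∧ v = gradient f p + u} ≤
      (1 + L * ν) * (‖p - x‖ / Real.sqrt γ) + L * (1 - ν) * γ ^ ((ν + 1) / (2 * (1 - ν)))
        + Real.sqrt γ * ‖gradient f x - G‖ := by
  set S := {v | ∃ u, (∀ y ∈ X, ⟪u, y - p⟫_ℝ ≤ 0) ∧ v = gradient f p + u} with hS
  have hs : 0 < Real.sqrt γ := Real.sqrt_pos.2 hγ
  have hmem : gradient f p + γ⁻¹ • ((x - γ • G) - p) ∈ S := by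
    refine ⟨_, fun y hy => ?_, rfl⟩
    rw [real_inner_smul_left]
    exact mul_nonpos_of_nonneg_of_nonpos (by positivity) (h1 y hy)
  have hdist := Metric.infDist_le_dist_of_mem (x := (0 : E)) hmem
  rw [dist_zero_left] at hdist
  have e : gradient f p + γ⁻¹ • ((x - γ • G) - p)
      = (gradient f p - gradient f x) + (gradient f x - G) + γ⁻¹ • (x - p) := by
    rw [sub_right_comm, smul_sub γ⁻¹ (x - p), smul_smul, inv_mul_cancel₀ hγ.ne', one_smul]
    abel
  rw [e] at hdist
  have hn := hdist.trans (norm_add₃_le)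
  rw [norm_smul, norm_sub_rev x p, Real.norm_of_nonneg (by positivity)] at hn
  have hh := hH x hx p hp
  set s := Real.sqrt γ with hsdef
  set r := ‖p - x‖ / s with hr
  have hr0 : 0 ≤ r := by positivity
  have hpr : ‖p - x‖ = s * r := by rw [hr]; field_simp
  have hsq : γ = s ^ 2 := (Real.sq_sqrt hγ.le).symm
  have hk : s * (γ⁻¹ * ‖p - x‖) = r := by rw [hpr, hsq]; field_simp
  have hy : s * ‖p - x‖ ^ ν ≤ ν * r + (1 - ν) * γ ^ ((ν + 1) / (2 * (1 - ν))) := by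
    have := Real.geom_mean_le_arith_mean2_weighted hν.le (by linarith : 0 ≤ 1 - ν) hr0
      (Real.rpow_nonneg hγ.le ((ν + 1) / (2 * (1 - ν)))) (by ring)
    refine le_trans (le_of_eq ?_) this
    rw [hpr, Real.mul_rpow hs.le hr0, ← Real.rpow_mul hγ.le]
    have : (ν + 1) / (2 * (1 - ν)) * (1 - ν) = 1 / 2 + 1 / 2 * ν := by
      have : 1 - ν ≠ 0 := by linarith
      field_simp; ring
    rw [this, Real.rpow_add hγ, Real.rpow_mul hγ.le, ← Real.sqrt_eq_rpow]
    ring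
  have h5 := mul_le_mul_of_nonneg_left hn hs.le
  have h6 := mul_le_mul_of_nonneg_left hh hs.le
  have h7 := mul_le_mul_of_nonneg_left hy hL.le
  nlinarith
end det

lemma spg_integral_le_sqrt {Ω : Type*} {m0 : MeasurableSpace Ω} (P : Measure Ω)
    [IsProbabilityMeasure P] (r : Ω → ℝ) (hr : MemLp r 2 P) (B : ℝ)
    (hB : ∫ ω, r ω ^ 2 ∂P ≤ B) : (∫ ω, r ω ∂P) ^ 2 ≤ B := by
  have := ProbabilityTheory.variance_nonneg r P
  rw [ProbabilityTheory.variance_eq_sub hr] at this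
  simp only [Pi.pow_apply] at this
  linarith

lemma spg_rpow_le (t a b : ℝ) (ht : 0 ≤ t) (ha : 0 ≤ a) (hab : a ≤ b) : t ^ a ≤ 1 + t ^ b := by
  rcases le_total t 1 with h | h
  · have := Real.rpow_le_one ht h ha
    have := Real.rpow_nonneg ht b
    linarith
  · have := Real.rpow_le_rpow_of_exponent_le h hab
    linarith

lemma spg_memLp_add_mul {Ω : Type*} {m0 : MeasurableSpace Ω} (P : Measure Ω)
    [IsProbabilityMeasure P] {E F : Type*} [NormedAddCommGroup E] [NormedAddCommGroup F]
    (u : Ω → E) (v : Ω → F) (hu : AEStronglyMeasurable u P) (hv : MemLp v 2 P) (a b : ℝ)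
    (h : ∀ ω, ‖u ω‖ ≤ a + b * ‖v ω‖) : MemLp u 2 P := by
  refine MemLp.mono' (g := fun ω => a + b * ‖v ω‖) ?_ hu (ae_of_all _ h)
  exact (memLp_const a).add (hv.norm.const_mul b)

lemma spg_inner_zero {Ω : Type*} {m m0 : MeasurableSpace Ω} (hm : m ≤ m0) (P : Measure Ω)
    [IsProbabilityMeasure P] {E : Type*} [NormedAddCommGroup E] [InnerProductSpace ℝ E]
    [CompleteSpace E]
    (z w : Ω → E) (hz : StronglyMeasurable[m] z) (hz2 : MemLp z 2 P) (hw : MemLp w 2 P)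
    (h0 : P[w|m] =ᵐ[P] 0) :
    Integrable (fun ω => ⟪z ω, w ω⟫_ℝ) P ∧ ∫ ω, ⟪z ω, w ω⟫_ℝ ∂P = 0 := by
  have hi : Integrable (fun ω => ⟪z ω, w ω⟫_ℝ) P := by
    refine (hz2.norm.integrable_mul hw.norm).mono'
      (hz2.aestronglyMeasurable.inner hw.aestronglyMeasurable) (ae_of_all _ fun ω => ?_)
    exact norm_inner_le_norm _ _
  refine ⟨hi, ?_⟩
  have hp := condExp_bilin_of_stronglyMeasurable_left (m := m) (μ := P) (innerSL ℝ (E := E)) hz hi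
    (hw.integrable (by norm_num))
  rw [← integral_condExp hm]
  refine integral_eq_zero_of_ae ?_
  filter_upwards [hp, h0] with ω h1 h2
  rw [h2] at h1
  exact h1.trans (by simp)


/-- Convergence theorem (case ν ∈ (0,1)) for the mini-batch stochastic projected gradient
method: the minimum over k < N of the expected stationarity measure
E[dist(0, ∇f(x_{k+1}) + N_𝒳(x_{k+1}))] is bounded by the stated quantity. -/
theorem spg_convergence_holder
    {Ω : Type*} {m0 : MeasurableSpace Ω} (P : Measure Ω) [IsProbabilityMeasure P]
    {d : ℕ} (𝒳 : Set (EuclideanSpace ℝ (Fin d)))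
    (h𝒳ne : 𝒳.Nonempty) (h𝒳closed : IsClosed 𝒳) (h𝒳conv : Convex ℝ 𝒳)
    (ν : ℝ) (hν : ν ∈ Set.Ioo (0 : ℝ) 1) (L : ℝ) (hL : 0 < L) (σ : ℝ) (hσ : 0 < σ)
    (f : EuclideanSpace ℝ (Fin d) → ℝ) (hf : Differentiable ℝ f)
    (hHolder : ∀ x ∈ 𝒳, ∀ y ∈ 𝒳, ‖gradient f y - gradient f x‖ ≤ L * ‖y - x‖ ^ ν)
    (fstar : ℝ) (hfstar : ∀ x ∈ 𝒳, fstar ≤ f x)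
    (ℱ : Filtration ℕ m0)
    (γ : ℕ → ℝ) (hγ : ∀ k, 0 < γ k)
    (γbar : ℝ) (hγbar : 0 < γbar) (hγle : ∀ k, γ k ≤ γbar)
    (mb : ℕ → ℕ) (hmb : ∀ k, 1 ≤ mb k)
    (x G : ℕ → Ω → EuclideanSpace ℝ (Fin d))
    (x0 : EuclideanSpace ℝ (Fin d)) (hx0 : ∀ ω, x 0 ω = x0)
    (hxmeas : ∀ k, Measurable[ℱ k] (x k))
    (hxmem : ∀ k ω, x k ω ∈ 𝒳)
    (hGint : ∀ k, Integrable (G k) P)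
    (hGcond : ∀ k, P[G k|ℱ k] =ᵐ[P] fun ω => gradient f (x k ω))
    (hGvarInt : ∀ k, Integrable (fun ω => ‖gradient f (x k ω) - G k ω‖ ^ 2) P)
    (hGvar : ∀ k, ∫ ω, ‖gradient f (x k ω) - G k ω‖ ^ 2 ∂P ≤ σ ^ 2 / mb k)
    (hGmomInt : ∀ k, Integrable (fun ω => ‖G k ω‖ ^ (1 + ν)) P)
    (hGmom : ∀ k, ∫ ω, ‖G k ω‖ ^ (1 + ν) ∂P ≤ σ ^ (1 + ν))
    (hproj : ∀ k, ∀ᵐ ω ∂P,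
      ∀ y ∈ 𝒳, ⟪(x k ω - γ k • G k ω) - x (k + 1) ω, y - x (k + 1) ω⟫_ℝ ≤ 0)
    (N : ℕ) (hN : 1 ≤ N) :
    Finset.inf' (Finset.range N) (Finset.nonempty_range_iff.mpr (Nat.one_le_iff_ne_zero.mp hN))
      (fun k => ∫ ω, Metric.infDist (0 : EuclideanSpace ℝ (Fin d))
        {v | ∃ u, (∀ y ∈ 𝒳, ⟪u, y - x (k + 1) ω⟫_ℝ ≤ 0)
          ∧ v = gradient f (x (k + 1) ω) + u} ∂P)
      ≤ ((1 + L * ν) * Real.sqrt N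
          * Real.sqrt ((f x0 - fstar) + σ ^ 2 * ∑ k ∈ Finset.range N, γ k / mb k
              + L * σ ^ (1 + ν) / (1 + ν) * ∑ k ∈ Finset.range N, γ k ^ (1 + ν))
         + L * (1 - ν) * ∑ k ∈ Finset.range N, γ k ^ ((ν + 1) / (2 * (1 - ν)))
         + σ * ∑ k ∈ Finset.range N, Real.sqrt (γ k / mb k))
        / ∑ k ∈ Finset.range N, Real.sqrt (γ k) := by
  obtain ⟨hν0, hν1⟩ := hν
  have hgm : Measurable (gradient f) := by
    have : gradient f = fun x => (toDual ℝ (EuclideanSpace ℝ (Fin d))).symm (fderiv ℝ f x) := rfl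
    rw [this]
    exact (LinearIsometryEquiv.continuous _).measurable.comp (measurable_fderiv ℝ f)
  have hxm : ∀ k, Measurable (x k) := fun k => (hxmeas k).mono (ℱ.le k) le_rfl
  have hgk : ∀ k, Measurable[ℱ k] (fun ω => gradient f (x k ω)) := fun k => hgm.comp (hxmeas k)
  have hgk' : ∀ k, Measurable (fun ω => gradient f (x k ω)) := fun k => hgm.comp (hxm k)
  have hdL2 : ∀ k, MemLp (fun ω => gradient f (x k ω) - G k ω) 2 P := fun k =>
    (memLp_two_iff_integrable_sq_norm
      ((hgk' k).aestronglyMeasurable.sub (hGint k).aestronglyMeasurable)).2 (hGvarInt k)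
  have hx0mem : x0 ∈ 𝒳 := hx0 (P.nonempty_of_neZero.some) ▸ hxmem 0 _
  have hgL2' : ∀ k, MemLp (fun ω => x k ω - x0) 2 P →
      MemLp (fun ω => gradient f (x k ω)) 2 P := by
    intro k hk
    refine spg_memLp_add_mul P _ _ (hgk' k).aestronglyMeasurable hk
      (‖gradient f x0‖ + L) L fun ω => ?_
    have h1 := hHolder x0 hx0mem (x k ω) (hxmem k ω)
    have h2 := spg_rpow_le ‖x k ω - x0‖ ν 1 (norm_nonneg _) hν0.le hν1.le
    rw [Real.rpow_one] at h2
    have h3 := norm_le_norm_add_norm_sub' (gradient f (x k ω)) (gradient f x0)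
    nlinarith
  have hGL2' : ∀ k, MemLp (fun ω => x k ω - x0) 2 P → MemLp (G k) 2 P := by
    intro k hk
    have := (hgL2' k hk).sub (hdL2 k)
    refine this.ae_eq (ae_of_all _ fun ω => ?_)
    simp
  have hstepL2' : ∀ k, MemLp (fun ω => x k ω - x0) 2 P →
      MemLp (fun ω => x (k + 1) ω - x k ω) 2 P := by
    intro k hk
    refine MemLp.of_le_mul (c := γ k) (hGL2' k hk)
      ((hxm (k+1)).sub (hxm k)).aestronglyMeasurable ?_
    filter_upwards [hproj k] with ω hω
    exact (spg_step_le 𝒳 _ _ _ (γ k) (hγ k) (hxmem k ω) hω).2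
  have hxL2 : ∀ k, MemLp (fun ω => x k ω - x0) 2 P := by
    intro k
    induction k with
    | zero => simp [hx0]
    | succ k ih =>
      refine ((hstepL2' k ih).add ih).ae_eq (ae_of_all _ fun ω => ?_)
      simp
  have hgL2 := fun k => hgL2' k (hxL2 k)
  have hGL2 := fun k => hGL2' k (hxL2 k)
  have hstepL2 := fun k => hstepL2' k (hxL2 k)
  have hfint : ∀ k, Integrable (fun ω => f (x k ω)) P := by
    intro k
    have hb : Integrable (fun ω => |f x0| + |fstar| + ‖gradient f x0‖ * ‖x k ω - x0‖
        + L / (1 + ν) * (1 + ‖x k ω - x0‖ ^ 2)) P := by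
      have i1 := ((hxL2 k).norm.integrable (by norm_num : (1 : ENNReal) ≤ 2)).const_mul
        ‖gradient f x0‖
      have i2 := (hxL2 k).norm.integrable_sq
      exact ((integrable_const (|f x0| + |fstar|)).add i1).add
        (((integrable_const (1 : ℝ)).add i2).const_mul _)
    refine hb.mono' (hf.continuous.measurable.comp (hxm k)).aestronglyMeasurable
      (ae_of_all _ fun ω => ?_)
    have h1 := spg_descent 𝒳 h𝒳conv ν L hν0 f hf hHolder x0 (x k ω) hx0mem (hxmem k ω)
    have h2 := hfstar _ (hxmem k ω)
    have h3 := real_inner_le_norm (gradient f x0) (x k ω - x0)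
    have h4 := spg_rpow_le ‖x k ω - x0‖ (1 + ν) 2 (norm_nonneg _) (by linarith) (by linarith)
    rw [Real.rpow_two] at h4
    have h5 : 0 ≤ L / (1 + ν) := by positivity
    have h6 := mul_le_mul_of_nonneg_left h4 h5
    have h7 : 0 ≤ ‖gradient f x0‖ * ‖x k ω - x0‖ := by positivity
    have h8 : 0 ≤ L / (1 + ν) * (1 + ‖x k ω - x0‖ ^ 2) := by positivity
    rw [Real.norm_eq_abs, abs_le]
    constructor
    · linarith [neg_abs_le fstar, abs_nonneg (f x0)]
    · linarith [le_abs_self (f x0), abs_nonneg fstar]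
  obtain ⟨p, hpc, hp⟩ := spg_proj 𝒳 h𝒳ne h𝒳closed h𝒳conv
  -- zero-mean inner product
  have hinner : ∀ k, Integrable (fun ω =>
      ⟪p (x k ω - γ k • gradient f (x k ω)) - x k ω, gradient f (x k ω) - G k ω⟫_ℝ) P ∧
      ∫ ω, ⟪p (x k ω - γ k • gradient f (x k ω)) - x k ω, gradient f (x k ω) - G k ω⟫_ℝ ∂P = 0 := by
    intro k
    have hzm : Measurable[ℱ k]
        (fun ω => p (x k ω - γ k • gradient f (x k ω)) - x k ω) := by
      have hc : Measurable (fun y => p (y - γ k • gradient f y) - y) :=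
        (hpc.measurable.comp (measurable_id.sub (hgm.const_smul (γ k)))).sub measurable_id
      exact hc.comp (hxmeas k)
    refine spg_inner_zero (ℱ.le k) P _ _ hzm.stronglyMeasurable ?_ (hdL2 k) ?_
    · refine MemLp.of_le_mul (c := γ k) (hgL2 k)
        (hzm.mono (ℱ.le k) le_rfl).aestronglyMeasurable (ae_of_all _ fun ω => ?_)
      exact (spg_step_le 𝒳 _ _ _ (γ k) (hγ k) (hxmem k ω) (hp _).2).2
    · have hgi : Integrable (fun ω => gradient f (x k ω)) P := (hgL2 k).integrable (by norm_num)
      have h1 := condExp_sub (m := ℱ k) hgi (hGint k)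
      have h2 := condExp_of_stronglyMeasurable (ℱ.le k) (hgk k).stronglyMeasurable hgi
      filter_upwards [h1, hGcond k] with ω a b
      have a' : P[fun ω => gradient f (x k ω) - G k ω|ℱ k] ω
        = (P[fun ω => gradient f (x k ω)|ℱ k] - P[G k|ℱ k]) ω := a
      rw [a', Pi.sub_apply, h2, b]
      simp
  -- one-step expected descent
  set r : ℕ → Ω → ℝ := fun k ω => ‖x (k + 1) ω - x k ω‖ / Real.sqrt (γ k) with hr
  have hrL2 : ∀ k, MemLp (r k) 2 P := by
    intro k
    refine ((hstepL2 k).norm.const_mul (Real.sqrt (γ k))⁻¹).ae_eq (ae_of_all _ fun ω => ?_)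
    simp only [hr]; rw [div_eq_inv_mul]
  have hrsq : ∀ k ω, r k ω ^ 2 = ‖x (k + 1) ω - x k ω‖ ^ 2 / γ k := by
    intro k ω
    simp only [hr]
    rw [div_pow, Real.sq_sqrt (hγ k).le]
  have hstep : ∀ k, ∫ ω, r k ω ^ 2 ∂P ≤ (∫ ω, f (x k ω) ∂P) - (∫ ω, f (x (k + 1) ω) ∂P)
      + (σ ^ 2 * (γ k / mb k) + L * σ ^ (1 + ν) / (1 + ν) * γ k ^ (1 + ν)) := by
    intro k
    set A : Ω → ℝ := fun ω => f (x k ω) - f (x (k + 1) ω) with hA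
    set B : Ω → ℝ := fun ω => γ k * ‖gradient f (x k ω) - G k ω‖ ^ 2 with hB
    set C : Ω → ℝ := fun ω =>
      ⟪p (x k ω - γ k • gradient f (x k ω)) - x k ω, gradient f (x k ω) - G k ω⟫_ℝ with hC
    set D : Ω → ℝ := fun ω => L / (1 + ν) * γ k ^ (1 + ν) * ‖G k ω‖ ^ (1 + ν) with hD
    have iA : Integrable A P := (hfint k).sub (hfint (k + 1))
    have iB : Integrable B P := (hGvarInt k).const_mul _
    have iC : Integrable C P := (hinner k).1
    have iD : Integrable D P := (hGmomInt k).const_mul _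
    have iAB : Integrable (fun ω => A ω + B ω) P := iA.add iB
    have iABC : Integrable (fun ω => A ω + B ω + C ω) P := iAB.add iC
    have iT : Integrable (fun ω => A ω + B ω + C ω + D ω) P := iABC.add iD
    have hle : ∫ ω, r k ω ^ 2 ∂P ≤ ∫ ω, (A ω + B ω + C ω + D ω) ∂P := by
      refine integral_mono_ae (hrL2 k).integrable_sq iT ?_
      filter_upwards [hproj k] with ω hω
      have := spg_onestep 𝒳 h𝒳conv ν L hν0 hL f hf hHolder (x k ω) (x (k + 1) ω)
        (p (x k ω - γ k • gradient f (x k ω))) (G k ω) (γ k) (hγ k) (hxmem k ω)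
        (hxmem (k + 1) ω) (hp _).1 hω (hp _).2
      simp only [hrsq, hA, hB, hC, hD]
      linarith
    rw [integral_add iABC iD, integral_add iAB iC, integral_add iA iB, (hinner k).2,
      integral_sub (hfint k) (hfint (k + 1)), integral_const_mul, integral_const_mul] at hle
    have h1 := mul_le_mul_of_nonneg_left (hGvar k) (hγ k).le
    have h2 : L / (1 + ν) * γ k ^ (1 + ν) * ∫ ω, ‖G k ω‖ ^ (1 + ν) ∂P ≤
        L / (1 + ν) * γ k ^ (1 + ν) * σ ^ (1 + ν) :=
      mul_le_mul_of_nonneg_left (hGmom k)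
        (mul_nonneg (by positivity) (Real.rpow_nonneg (hγ k).le _))
    have e1 : γ k * (σ ^ 2 / mb k) = σ ^ 2 * (γ k / mb k) := by ring
    have e2 : L / (1 + ν) * γ k ^ (1 + ν) * σ ^ (1 + ν)
      = L * σ ^ (1 + ν) / (1 + ν) * γ k ^ (1 + ν) := by ring
    linarith
  set T : ℝ := (f x0 - fstar) + σ ^ 2 * ∑ k ∈ Finset.range N, γ k / mb k
              + L * σ ^ (1 + ν) / (1 + ν) * ∑ k ∈ Finset.range N, γ k ^ (1 + ν) with hT
  have hsumsq : ∑ k ∈ Finset.range N, ∫ ω, r k ω ^ 2 ∂P ≤ T := by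
    refine (Finset.sum_le_sum fun k _ => hstep k).trans ?_
    rw [Finset.sum_add_distrib, Finset.sum_range_sub' (fun k => ∫ ω, f (x k ω) ∂P),
      Finset.sum_add_distrib, ← Finset.mul_sum, ← Finset.mul_sum]
    have h0 : ∫ ω, f (x 0 ω) ∂P = f x0 := by simp [hx0]
    have h1 : fstar ≤ ∫ ω, f (x N ω) ∂P := by
      have := integral_mono (integrable_const fstar) (hfint N) (fun ω => hfstar _ (hxmem N ω))
      simpa using this
    rw [h0, hT]
    linarith
  have hsum : ∑ k ∈ Finset.range N, ∫ ω, r k ω ∂P ≤ Real.sqrt N * Real.sqrt T := by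
    rw [← Real.sqrt_mul (Nat.cast_nonneg N)]
    apply Real.le_sqrt_of_sq_le
    refine sq_sum_le_card_mul_sum_sq.trans ?_
    rw [Finset.card_range]
    refine mul_le_mul_of_nonneg_left (le_trans (Finset.sum_le_sum fun k _ => ?_) hsumsq)
      (Nat.cast_nonneg N)
    exact spg_integral_le_sqrt P (r k) (hrL2 k) _ le_rfl
  -- stationarity
  have hstat : ∀ k, Real.sqrt (γ k) * (∫ ω, Metric.infDist (0 : EuclideanSpace ℝ (Fin d))
        {v | ∃ u, (∀ y ∈ 𝒳, ⟪u, y - x (k + 1) ω⟫_ℝ ≤ 0)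
          ∧ v = gradient f (x (k + 1) ω) + u} ∂P) ≤ (1 + L * ν) * (∫ ω, r k ω ∂P)
          + L * (1 - ν) * γ k ^ ((ν + 1) / (2 * (1 - ν))) + σ * Real.sqrt (γ k / mb k) := by
    intro k
    have iR : Integrable (r k) P := (hrL2 k).integrable (by norm_num)
    have iN : Integrable (fun ω => ‖gradient f (x k ω) - G k ω‖) P :=
      (hdL2 k).norm.integrable (by norm_num)
    have i1 : Integrable (fun ω => (1 + L * ν) * r k ω) P := iR.const_mul _
    have i2 : Integrable (fun ω => (1 + L * ν) * r k ω
      + L * (1 - ν) * γ k ^ ((ν + 1) / (2 * (1 - ν)))) P := i1.add (integrable_const _)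
    have i3 : Integrable (fun ω => Real.sqrt (γ k) * ‖gradient f (x k ω) - G k ω‖) P :=
      iN.const_mul _
    have hle := integral_mono_of_nonneg (μ := P)
      (f := fun ω => Real.sqrt (γ k) * Metric.infDist (0 : EuclideanSpace ℝ (Fin d))
        {v | ∃ u, (∀ y ∈ 𝒳, ⟪u, y - x (k + 1) ω⟫_ℝ ≤ 0)
          ∧ v = gradient f (x (k + 1) ω) + u})
      (g := fun ω => (1 + L * ν) * r k ω + L * (1 - ν) * γ k ^ ((ν + 1) / (2 * (1 - ν)))
        + Real.sqrt (γ k) * ‖gradient f (x k ω) - G k ω‖)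
      (ae_of_all _ fun ω => mul_nonneg (Real.sqrt_nonneg _) Metric.infDist_nonneg)
      (i2.add i3) (by
        filter_upwards [hproj k] with ω hω
        exact spg_stat 𝒳 ν L hν0 hν1 hL f hHolder (x k ω) (x (k + 1) ω) (G k ω) (γ k) (hγ k)
          (hxmem k ω) (hxmem (k + 1) ω) hω)
    rw [integral_const_mul, integral_add i2 i3, integral_add i1 (integrable_const _),
      integral_const_mul, integral_const_mul, integral_const] at hle
    simp only [probReal_univ, one_smul, integral_const_mul] at hle
    have hv : ∫ ω, ‖gradient f (x k ω) - G k ω‖ ∂P ≤ σ / Real.sqrt (mb k) := by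
      have h1 := spg_integral_le_sqrt P _ (hdL2 k).norm _ (hGvar k)
      refine (abs_le_of_sq_le_sq' ?_ (by positivity)).2
      rwa [div_pow, Real.sq_sqrt (Nat.cast_nonneg _)]
    have hv2 := mul_le_mul_of_nonneg_left hv (Real.sqrt_nonneg (γ k))
    have e : Real.sqrt (γ k) * (σ / Real.sqrt (mb k)) = σ * Real.sqrt (γ k / mb k) := by
      rw [Real.sqrt_div (hγ k).le]; ring
    linarith
  have hSpos : 0 < ∑ k ∈ Finset.range N, Real.sqrt (γ k) :=
    Finset.sum_pos (fun k _ => Real.sqrt_pos.2 (hγ k))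
      (Finset.nonempty_range_iff.mpr (Nat.one_le_iff_ne_zero.mp hN))
  rw [le_div_iff₀ hSpos, Finset.mul_sum]
  have key := Finset.sum_le_sum (s := Finset.range N) fun k _ => hstat k
  rw [Finset.sum_add_distrib, Finset.sum_add_distrib, ← Finset.mul_sum, ← Finset.mul_sum,
    ← Finset.mul_sum] at key
  have hc : 0 ≤ 1 + L * ν := by positivity
  have hfin := mul_le_mul_of_nonneg_left hsum hc
  rw [← mul_assoc] at hfin
  refine le_trans (Finset.sum_le_sum fun k hk => ?_) (key.trans (by linarith))
  rw [mul_comm]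
  exact mul_le_mul_of_nonneg_left (Finset.inf'_le _ hk) (Real.sqrt_nonneg _)
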